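/- Let p ≥ 2, a₁,…,a_p ≥ 0 with a₁ + ⋯ + a_p > 1, and λ > 0. Then the discrete-time Hawkes chain with memory p and parameters (a₁,…,a_p,λ), started at (0,…,0) ∈ ℕ^p, never returns to (0,…,0) with positive probability: denoting by P_{(0,…,0)} the trajectory law of the chain started at X₀ = (0,…,0), one has P_{(0,…,0)}(X_n ≠ (0,…,0) for all n ≥ 1) > 0; in particular the chain is transient. -/

import Mathlib

open scoped BigOperators
open Classical MeasureTheory

/-- The Poisson probability mass function with parameter `s` at `k`. -/
noncomputable def poissonPMF (s : ℝ) (k : ℕ) : ℝ :=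
  Real.exp (-s) * s ^ k / (Nat.factorial k)

/-- The (truncated) intensity `s_x = max(a₁x₁ + ⋯ + a_p x_p + λ, 0)`. -/
noncomputable def hawkesS {p : ℕ} (a : Fin p → ℝ) (lam : ℝ) (x : Fin p → ℕ) : ℝ :=
  max (∑ i, a i * (x i : ℝ) + lam) 0

/-- Transition kernel of the discrete-time Hawkes chain with memory `p`:
from `x = (x₁,…,x_p)` the chain moves to `(ℓ, x₁,…,x_{p−1})` with `ℓ`
Poisson distributed with parameter `s_x`. -/
noncomputable def hawkesP {p : ℕ} (hp : 0 < p) (a : Fin p → ℝ) (lam : ℝ)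
    (x y : Fin p → ℕ) : ℝ :=
  if ∀ i : Fin p, ∀ h : (i : ℕ) + 1 < p, y ⟨(i : ℕ) + 1, h⟩ = x i
  then poissonPMF (hawkesS a lam x) (y ⟨0, hp⟩) else 0

/-- Tail sums of the parameters. -/
noncomputable def hwT {q : ℕ} (a : Fin (q+1) → ℝ) (i : Fin (q+1)) : ℝ :=
  ∑ j, if i ≤ j then a j else 0

/-- The Lyapunov function. -/
noncomputable def hwF {q : ℕ} (a : Fin (q+1) → ℝ) (c : ℝ) (x : Fin (q+1) → ℕ) : ℝ :=
  Real.exp (-(c * ∑ i, hwT a i * (x i : ℝ)))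

lemma hwT_castSucc {q : ℕ} (a : Fin (q+1) → ℝ) (i : Fin q) :
    hwT a i.castSucc = a i.castSucc + hwT a i.succ := by
  unfold hwT
  have : a i.castSucc = ∑ j, if j = i.castSucc then a j else 0 := by simp
  rw [this, ← Finset.sum_add_distrib]
  refine Finset.sum_congr rfl fun j _ => ?_
  rcases lt_trichotomy j i.castSucc with h | h | h
  · have h1 : ¬ i.castSucc ≤ j := not_le.mpr h
    have h2 : ¬ i.succ ≤ j := fun h' => h1 (le_trans (Fin.castSucc_lt_succ).le h')
    simp [h1, h2, h.ne]
  · subst h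
    have h2 : ¬ i.succ ≤ i.castSucc := not_le.mpr Fin.castSucc_lt_succ
    simp [h2]
  · have h2 : i.succ ≤ j := by
      rw [Fin.le_def]; rw [Fin.lt_def] at h; simp at h ⊢; omega
    simp [h.le, h2, h.ne']

lemma hwT_last {q : ℕ} (a : Fin (q+1) → ℝ) : hwT a (Fin.last q) = a (Fin.last q) := by
  unfold hwT
  simp [Fin.last_le_iff]

lemma hwT_zero {q : ℕ} (a : Fin (q+1) → ℝ) : hwT a 0 = ∑ i, a i := by
  unfold hwT
  simp

lemma hwT_sum {q : ℕ} (a : Fin (q+1) → ℝ) (x : Fin (q+1) → ℕ) :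
    ∑ i, hwT a i * (x i : ℝ) = ∑ i, a i * (x i : ℝ)
      + ∑ i : Fin q, hwT a i.succ * (x i.castSucc : ℝ) := by
  rw [Fin.sum_univ_castSucc, Fin.sum_univ_castSucc (fun i => a i * (x i : ℝ)), hwT_last]
  simp only [hwT_castSucc, add_mul, Finset.sum_add_distrib]
  ring

/-- The next state. -/
def hwNext {q : ℕ} (x : Fin (q+1) → ℕ) (l : ℕ) : Fin (q+1) → ℕ :=
  Fin.cons l (fun i => x i.castSucc)

lemma hwNext_inj {q : ℕ} (x : Fin (q+1) → ℕ) : Function.Injective (hwNext x) := by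
  intro l m h
  have := congrFun h 0
  simpa [hwNext] using this

lemma hawkesP_next {q : ℕ} (hq : 0 < q + 1) (a : Fin (q+1) → ℝ) (lam : ℝ)
    (x : Fin (q+1) → ℕ) (l : ℕ) :
    hawkesP hq a lam x (hwNext x l) = poissonPMF (hawkesS a lam x) l := by
  unfold hawkesP
  rw [if_pos]
  · rfl
  · intro i h
    have hi : (i : ℕ) < q := by omega
    have : (⟨(i : ℕ) + 1, h⟩ : Fin (q+1)) = Fin.succ ⟨i, hi⟩ := rfl
    rw [this]
    simp only [hwNext, Fin.cons_succ]
    rfl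

lemma hawkesP_supp {q : ℕ} (hq : 0 < q + 1) (a : Fin (q+1) → ℝ) (lam : ℝ)
    (x y : Fin (q+1) → ℕ) (h : hawkesP hq a lam x y ≠ 0) : y ∈ Set.range (hwNext x) := by
  unfold hawkesP at h
  split_ifs at h with h1
  · refine ⟨y 0, ?_⟩
    funext i
    refine Fin.cases ?_ (fun j => ?_) i
    · simp [hwNext]
    · simp only [hwNext, Fin.cons_succ]
      exact (h1 j.castSucc (by simp)).symm
  · exact absurd rfl h

lemma poisson_nonneg {s : ℝ} (hs : 0 ≤ s) (k : ℕ) : 0 ≤ poissonPMF s k := by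
  unfold poissonPMF; positivity

lemma hawkesP_nonneg {q : ℕ} (hq : 0 < q + 1) (a : Fin (q+1) → ℝ) (lam : ℝ)
    (x y : Fin (q+1) → ℕ) : 0 ≤ hawkesP hq a lam x y := by
  unfold hawkesP
  split_ifs
  · exact poisson_nonneg (le_max_right _ _) _
  · exact le_rfl

lemma hw_hasSum {s : ℝ} (t K : ℝ) :
    HasSum (fun l : ℕ => poissonPMF s l * Real.exp (-(t * l + K)))
      (Real.exp (-s + s * Real.exp (-t) - K)) := by
  have h := NormedSpace.expSeries_div_hasSum_exp (s * Real.exp (-t))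
  rw [← Real.exp_eq_exp_ℝ] at h
  have h2 := h.mul_left (Real.exp (-s - K))
  rw [← Real.exp_add] at h2
  have e1 : (fun l : ℕ => poissonPMF s l * Real.exp (-(t * l + K))) =
      fun i : ℕ => Real.exp (-s - K) * ((s * Real.exp (-t)) ^ i / (Nat.factorial i : ℝ)) := by
    funext l
    unfold poissonPMF
    rw [mul_pow, ← Real.exp_nat_mul, show -(t * l + K) = (l * (-t)) + (-K) by ring,
      Real.exp_add, show -s - K = -s + -K by ring, Real.exp_add]
    ring
  rw [e1, show -s + s * Real.exp (-t) - K = -s - K + s * Real.exp (-t) by ring]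
  exact h2

lemma hw_superharmonic {q : ℕ} (hq : 0 < q + 1) (a : Fin (q+1) → ℝ) (ha : ∀ i, 0 ≤ a i)
    (lam : ℝ) (hlam : 0 < lam) (c : ℝ)
    (hc : Real.exp (-(c * ∑ i, a i)) ≤ 1 - c) (x : Fin (q+1) → ℕ) :
    ∑' y, ENNReal.ofReal (hawkesP hq a lam x y) * ENNReal.ofReal (hwF a c y)
      ≤ ENNReal.ofReal (Real.exp (-(c * lam)) * hwF a c x) := by
  have hS : hawkesS a lam x = ∑ i, a i * (x i : ℝ) + lam := by
    unfold hawkesS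
    rw [max_eq_left]
    have : 0 ≤ ∑ i, a i * (x i : ℝ) :=
      Finset.sum_nonneg fun i _ => mul_nonneg (ha i) (Nat.cast_nonneg _)
    linarith
  have hS0 : 0 ≤ hawkesS a lam x := le_max_right _ _
  rw [← (hwNext_inj x).tsum_eq]
  swap
  · intro y hy
    apply hawkesP_supp hq a lam
    intro h0
    simp [h0] at hy
  have hF : ∀ l : ℕ, hwF a c (hwNext x l) = Real.exp (-((c * ∑ i, a i) * l
      + c * ∑ i : Fin q, hwT a i.succ * (x i.castSucc : ℝ))) := by
    intro l
    unfold hwF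
    rw [Fin.sum_univ_succ, hwT_zero]
    simp only [hwNext, Fin.cons_zero, Fin.cons_succ]
    congr 1; ring
  have hs := hw_hasSum (s := hawkesS a lam x) (c * ∑ i, a i)
    (c * ∑ i : Fin q, hwT a i.succ * (x i.castSucc : ℝ))
  have e : ∀ l : ℕ, ENNReal.ofReal (hawkesP hq a lam x (hwNext x l))
      * ENNReal.ofReal (hwF a c (hwNext x l))
      = ENNReal.ofReal (poissonPMF (hawkesS a lam x) l * Real.exp (-((c * ∑ i, a i) * l
      + c * ∑ i : Fin q, hwT a i.succ * (x i.castSucc : ℝ)))) := by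
    intro l
    rw [hawkesP_next, hF, ENNReal.ofReal_mul (poisson_nonneg hS0 l)]
  simp only [e]
  rw [← ENNReal.ofReal_tsum_of_nonneg
    (fun l => mul_nonneg (poisson_nonneg hS0 l) (Real.exp_nonneg _)) hs.summable, hs.tsum_eq]
  apply ENNReal.ofReal_le_ofReal
  unfold hwF
  rw [← Real.exp_add, hwT_sum]
  apply Real.exp_le_exp.mpr
  have := mul_le_mul_of_nonneg_left hc hS0
  have h3 : hawkesS a lam x * c = (∑ i, a i * (x i : ℝ) + lam) * c := by rw [hS]
  nlinarith

/-- Cylinder sets. -/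
def hwC {α : Type*} (s : ℕ → α) (n : ℕ) : Set (ℕ → α) := {ω | ∀ i ≤ n, ω i = s i}

lemma hwC_union {α : Type*} (s : ℕ → α) (n : ℕ) (z : α) (k : ℕ) :
    hwC s n ∩ {ω | ∃ i, n + 1 ≤ i ∧ i ≤ n + 1 + k ∧ ω i = z} ⊆
      ⋃ y, hwC (Function.update s (n+1) y) (n+1) ∩
        {ω | ∃ i, n + 1 ≤ i ∧ i ≤ n + 1 + k ∧ ω i = z} := by
  rintro ω ⟨h1, h2⟩
  refine Set.mem_iUnion.mpr ⟨ω (n+1), ?_, h2⟩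
  intro i hi
  by_cases h : i = n + 1
  · subst h; simp
  · rw [Function.update_of_ne h]
    exact h1 i (by omega)

lemma hw_cyl_succ {q : ℕ} (hq : 0 < q + 1) (a : Fin (q+1) → ℝ)
    (lam : ℝ)
    (ν : Measure (ℕ → Fin (q+1) → ℕ)) [IsProbabilityMeasure ν] (x₀ : Fin (q+1) → ℕ)
    (hcyl : ∀ (n : ℕ) (s : ℕ → Fin (q+1) → ℕ),
      (ν {ω | ∀ i ≤ n, ω i = s i}).toReal
        = (if s 0 = x₀ then 1 else 0)
            * ∏ i ∈ Finset.range n, hawkesP hq a lam (s i) (s (i + 1)))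
    (n : ℕ) (s : ℕ → Fin (q+1) → ℕ) (y : Fin (q+1) → ℕ) :
    ν (hwC (Function.update s (n+1) y) (n+1))
      = ν (hwC s n) * ENNReal.ofReal (hawkesP hq a lam (s n) y) := by
  rw [← ENNReal.toReal_eq_toReal_iff' (measure_ne_top _ _)
    (ENNReal.mul_ne_top (measure_ne_top _ _) ENNReal.ofReal_ne_top), ENNReal.toReal_mul,
    ENNReal.toReal_ofReal (hawkesP_nonneg _ _ _ _ _)]
  unfold hwC
  rw [hcyl, hcyl, Finset.prod_range_succ, Function.update_self,
    Function.update_of_ne (show n ≠ n + 1 by omega),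
    Function.update_of_ne (show 0 ≠ n + 1 by omega), mul_assoc]
  congr 2
  refine Finset.prod_congr rfl fun i hi => ?_
  rw [Finset.mem_range] at hi
  rw [Function.update_of_ne (by omega), Function.update_of_ne (by omega)]

lemma hw_hit {q : ℕ} (hq : 0 < q + 1) (a : Fin (q+1) → ℝ) (ha : ∀ i, 0 ≤ a i)
    (lam : ℝ) (hlam : 0 < lam) (c : ℝ) (hc0 : 0 < c)
    (hc : Real.exp (-(c * ∑ i, a i)) ≤ 1 - c)
    (ν : Measure (ℕ → Fin (q+1) → ℕ)) [IsProbabilityMeasure ν] (x₀ : Fin (q+1) → ℕ)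
    (hcyl : ∀ (n : ℕ) (s : ℕ → Fin (q+1) → ℕ),
      (ν {ω | ∀ i ≤ n, ω i = s i}).toReal
        = (if s 0 = x₀ then 1 else 0)
            * ∏ i ∈ Finset.range n, hawkesP hq a lam (s i) (s (i + 1)))
    (k : ℕ) : ∀ (n : ℕ) (s : ℕ → Fin (q+1) → ℕ),
    ν (hwC s n ∩ {ω | ∃ i, n ≤ i ∧ i ≤ n + k ∧ ω i = 0})
      ≤ ν (hwC s n) * ENNReal.ofReal (hwF a c (s n)) ∧
    ν (hwC s n ∩ {ω | ∃ i, n + 1 ≤ i ∧ i ≤ n + 1 + k ∧ ω i = 0})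
      ≤ ν (hwC s n) * ENNReal.ofReal (Real.exp (-(c * lam)) * hwF a c (s n)) := by
  have zero_case : ∀ (k n : ℕ) (s : ℕ → Fin (q+1) → ℕ), s n = 0 →
      ν (hwC s n ∩ {ω | ∃ i, n ≤ i ∧ i ≤ n + k ∧ ω i = 0})
      ≤ ν (hwC s n) * ENNReal.ofReal (hwF a c (s n)) := by
    intro k n s h
    have : hwF a c (s n) = 1 := by simp [hwF, h]
    rw [this, ENNReal.ofReal_one, mul_one]
    exact measure_mono Set.inter_subset_left
  have step : ∀ k : ℕ, (∀ (n : ℕ) (s : ℕ → Fin (q+1) → ℕ),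
      ν (hwC s n ∩ {ω | ∃ i, n ≤ i ∧ i ≤ n + k ∧ ω i = 0})
      ≤ ν (hwC s n) * ENNReal.ofReal (hwF a c (s n))) →
      ∀ (n : ℕ) (s : ℕ → Fin (q+1) → ℕ),
      ν (hwC s n ∩ {ω | ∃ i, n + 1 ≤ i ∧ i ≤ n + 1 + k ∧ ω i = 0})
      ≤ ν (hwC s n) * ENNReal.ofReal (Real.exp (-(c * lam)) * hwF a c (s n)) := by
    intro k ih n s
    calc _ ≤ ν (⋃ y, hwC (Function.update s (n+1) y) (n+1) ∩
        {ω | ∃ i, n + 1 ≤ i ∧ i ≤ n + 1 + k ∧ ω i = 0}) := measure_mono (hwC_union s n 0 k)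
      _ ≤ ∑' y, ν (hwC (Function.update s (n+1) y) (n+1) ∩
        {ω | ∃ i, n + 1 ≤ i ∧ i ≤ n + 1 + k ∧ ω i = 0}) := measure_iUnion_le _
      _ ≤ ∑' y, ν (hwC s n) * (ENNReal.ofReal (hawkesP hq a lam (s n) y)
          * ENNReal.ofReal (hwF a c y)) := by
        refine ENNReal.tsum_le_tsum fun y => ?_
        refine (ih (n+1) (Function.update s (n+1) y)).trans ?_
        rw [hw_cyl_succ hq a lam ν x₀ hcyl, Function.update_self, mul_assoc]
      _ ≤ _ := by
        rw [ENNReal.tsum_mul_left]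
        gcongr
        exact hw_superharmonic hq a ha lam hlam c hc (s n)
  have main : ∀ (n : ℕ) (s : ℕ → Fin (q+1) → ℕ),
      ν (hwC s n ∩ {ω | ∃ i, n ≤ i ∧ i ≤ n + k ∧ ω i = 0})
      ≤ ν (hwC s n) * ENNReal.ofReal (hwF a c (s n)) := by
    induction k with
    | zero =>
      intro n s
      by_cases h : s n = 0
      · exact zero_case 0 n s h
      · have : hwC s n ∩ {ω | ∃ i, n ≤ i ∧ i ≤ n + 0 ∧ ω i = 0} = ∅ := by
          ext ω
          simp only [Set.mem_inter_iff, Set.mem_empty_iff_false, iff_false]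
          rintro ⟨h1, i, h2, h3, h4⟩
          obtain rfl : i = n := by omega
          exact h ((h1 i le_rfl).symm.trans h4)
        rw [this]; simp
    | succ k ih =>
      intro n s
      by_cases h : s n = 0
      · exact zero_case (k+1) n s h
      · refine (measure_mono ?_).trans ((step k ih n s).trans ?_)
        · rintro ω ⟨h1, i, h2, h3, h4⟩
          refine ⟨h1, i, ?_, by omega, h4⟩
          rcases Nat.lt_or_ge n i with h5 | h5
          · exact h5
          · obtain rfl : i = n := by omega
            exact absurd ((h1 i le_rfl).symm.trans h4) h
        · gcongr
          have h1 : Real.exp (-(c * lam)) ≤ 1 := Real.exp_le_one_iff.mpr (by nlinarith)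
          have h2 : 0 ≤ hwF a c (s n) := Real.exp_nonneg _
          nlinarith
  exact fun n s => ⟨main n s, step k main n s⟩

/-- If `p ≥ 2`, `a₁, …, a_p ≥ 0` and `a₁ + ⋯ + a_p > 1`, then the discrete-time Hawkes
chain with memory `p` and parameters `(a₁,…,a_p,λ)`, started at `(0,…,0)`, never returns
to `(0,…,0)` with positive probability (hence is transient). Here `μ x` is the trajectory
law of the chain started at `x`, characterized by the cylinder formula
(Ionescu-Tulcea construction). -/
theorem hawkesP_transient_supercritical (p : ℕ) (hp : 2 ≤ p)
    (a : Fin p → ℝ) (ha : ∀ i, 0 ≤ a i) (hsum : 1 < ∑ i, a i)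
    (lam : ℝ) (hlam : 0 < lam)
    (μ : (Fin p → ℕ) → Measure (ℕ → Fin p → ℕ))
    (hprob : ∀ x, IsProbabilityMeasure (μ x))
    (hcyl : ∀ (x : Fin p → ℕ) (n : ℕ) (s : ℕ → Fin p → ℕ),
      (μ x {ω | ∀ i ≤ n, ω i = s i}).toReal
        = (if s 0 = x then 1 else 0)
            * ∏ i ∈ Finset.range n,
                hawkesP (by omega) a lam (s i) (s (i + 1))) :
    0 < μ (fun _ => 0) {ω | ∀ n ≥ 1, ω n ≠ fun _ => 0} := by
  obtain ⟨q, rfl⟩ : ∃ q, p = q + 1 := ⟨p - 1, by omega⟩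
  have hA : 0 < ∑ i, a i := by linarith
  set A := ∑ i, a i with hAdef
  have hc0 : 0 < (A - 1) / A := div_pos (by linarith) hA
  set c := (A - 1) / A with hcdef
  have hc : Real.exp (-(c * ∑ i, a i)) ≤ 1 - c := by
    have h1 : c * ∑ i, a i = A - 1 := by
      rw [← hAdef, hcdef]; field_simp
    have h2 : 1 - c = A⁻¹ := by rw [hcdef]; field_simp; ring
    rw [h1, h2, Real.exp_neg]
    apply inv_anti₀ hA
    have := Real.add_one_le_exp (A - 1)
    linarith
  have := hprob (fun _ => 0)
  have hit := fun k => (hw_hit (by omega) a ha lam hlam c hc0 hc (μ (fun _ => 0)) (fun _ => 0)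
    (hcyl (fun _ => 0)) k 0 (fun _ => 0)).2
  have hfull : μ (fun _ => 0) (hwC (fun _ => (fun _ => 0 : Fin (q+1) → ℕ)) 0) = 1 := by
    rw [← ENNReal.toReal_eq_toReal_iff' (measure_ne_top _ _) ENNReal.one_ne_top]
    unfold hwC
    rw [hcyl]
    simp
  have hF : hwF a c (fun _ => 0) = 1 := by simp [hwF]
  set B : ℕ → Set (ℕ → Fin (q+1) → ℕ) := fun k =>
    hwC (fun _ => (fun _ => 0 : Fin (q+1) → ℕ)) 0 ∩
      {ω | ∃ i, 0 + 1 ≤ i ∧ i ≤ 0 + 1 + k ∧ ω i = 0} with hB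
  have hBmono : Monotone B := by
    rintro k l hkl ω ⟨h1, i, h2, h3, h4⟩
    exact ⟨h1, i, h2, by omega, h4⟩
  have hBle : μ (fun _ => 0) (⋃ k, B k) ≤ ENNReal.ofReal (Real.exp (-(c * lam))) := by
    rw [hBmono.measure_iUnion]
    refine iSup_le fun k => ?_
    refine (hit k).trans ?_
    change μ (fun _ => 0) (hwC (fun _ => (fun _ => 0 : Fin (q+1) → ℕ)) 0)
      * ENNReal.ofReal (Real.exp (-(c * lam)) * hwF a c (fun _ => 0)) ≤ _
    rw [hfull, hF, one_mul, mul_one]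
  have hlt : ENNReal.ofReal (Real.exp (-(c * lam))) < 1 := by
    rw [← ENNReal.ofReal_one, ENNReal.ofReal_lt_ofReal_iff one_pos, Real.exp_lt_one_iff]
    nlinarith
  rw [pos_iff_ne_zero]
  intro h0
  have hcov : hwC (fun _ => (fun _ => 0 : Fin (q+1) → ℕ)) 0 ⊆
      (⋃ k, B k) ∪ {ω | ∀ n ≥ 1, ω n ≠ fun _ => 0} := by
    intro ω hω
    by_cases h : ∀ n ≥ 1, ω n ≠ fun _ => 0
    · exact Or.inr h
    · push Not at h
      obtain ⟨n, hn, h⟩ := h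
      exact Or.inl (Set.mem_iUnion.mpr ⟨n, hω, n, by omega, by omega, h⟩)
  have := (measure_mono (μ := μ (fun _ => 0)) hcov).trans (measure_union_le _ _)
  rw [h0, hfull, add_zero] at this
  exact absurd (this.trans hBle) (not_le.mpr hlt)
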